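/- arXiv:math/0212147 — 2 statements merged into one kernel-verified Lean document; each statement's English description precedes it below -/
import Mathlib

section
/- A tuple (x, y, y/x, (1-x⁻¹)/(1-y⁻¹), (1-x)/(1-y)) ∈ FT lies in FT⁺ if and only if y lies in the open upper half-plane and x lies in the interior of the triangle with vertices 0, 1, y. Moreover, FT⁺ is a connected subset of ℂ⁵. -/
open Complex
open scoped Classical

noncomputable section

namespace ExtendedBloch

/-- `π` as a complex number. -/
def Cpi : ℂ := (Real.pi : ℂ)

/-- Membership in `ℂ ∖ {0,1}`. -/
def Reg (z : ℂ) : Prop := z ≠ 0 ∧ z ≠ 1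

/-- The open upper half plane. -/
def UHP : Set ℂ := {z : ℂ | 0 < z.im}

/-- The 5-tuple occurring in the five term relation. -/
def ftTuple (x y : ℂ) : Fin 5 → ℂ :=
  ![x, y, y / x, (1 - x⁻¹) / (1 - y⁻¹), (1 - x) / (1 - y)]

/-- The set `FT` of five term tuples. -/
def FT : Set (Fin 5 → ℂ) :=
  {v | ∃ x y : ℂ, Reg x ∧ Reg y ∧ x ≠ y ∧ v = ftTuple x y}

/-- The subset `FT⁺` of tuples with all coordinates in the upper half plane. -/
def FTplus : Set (Fin 5 → ℂ) := {v | v ∈ FT ∧ ∀ i, v i ∈ UHP}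

/-- The point `(z; p, q)` of the cover `𝓒` of `ℂ ∖ {0,1}`, realized concretely as the pair of
branch values `(log z + pπi, -log(1-z) + qπi)` (Riemann surface model of `𝓒`). -/
def pt (z : ℂ) (p q : ℤ) : ℂ × ℂ :=
  (Complex.log z + p * (Cpi * I), -Complex.log (1 - z) + q * (Cpi * I))

/-- The cover `𝓒`, realized as the Riemann surface of all branches of
`(log z + pπi, -log(1-z) + qπi)` on `ℂ ∖ {0,1}`. -/
def Cover : Set (ℂ × ℂ) := {w | ∃ z : ℂ, Reg z ∧ ∃ p q : ℤ, w = pt z p q}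

lemma pt_mem_Cover {z : ℂ} (h : Reg z) (p q : ℤ) : pt z p q ∈ Cover :=
  ⟨z, h, p, q, rfl⟩

/-- `w ∈ 𝓒` lies over `z ∈ ℂ ∖ {0,1}`. -/
def LiesOver (w : ℂ × ℂ) (z : ℂ) : Prop := Reg z ∧ ∃ p q : ℤ, w = pt z p q

/-- The covering action of `ℤ × ℤ` on `𝓒`. -/
def covAct (v : ℤ × ℤ) (w : ℂ × ℂ) : ℂ × ℂ :=
  (w.1 + v.1 * (Cpi * I), w.2 + v.2 * (Cpi * I))

/-- The subset `V ⊂ (ℤ × ℤ)⁵`. -/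
def Vset : Set (Fin 5 → ℤ × ℤ) :=
  {v | ∃ p₀ p₁ q₀ q₁ q₂ : ℤ,
    v = ![(p₀, q₀), (p₁, q₁), (p₁ - p₀, q₂), (p₁ - p₀ + q₁ - q₀, q₂ - q₁),
          (q₁ - q₀, q₂ - q₁ - p₀)]}

/-- The preimage of `FT` in `𝓒⁵`. -/
def FTpre : Set (Fin 5 → ℂ × ℂ) := {w | ∃ v ∈ FT, ∀ i, LiesOver (w i) (v i)}

/-- A base point `((x₀;0,0),…,(x₄;0,0))` with `(x₀,…,x₄) ∈ FT⁺`. -/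
def basePt : Fin 5 → ℂ × ℂ := fun i => pt (ftTuple ((1 + I) / 4) I i) 0 0

/-- `𝓕𝓣̂₀`: the connected component of the preimage of `FT` in `𝓒⁵` containing the points
`((x₀;0,0),…,(x₄;0,0))` with `(x₀,…,x₄) ∈ FT⁺`. -/
def FThat₀ : Set (Fin 5 → ℂ × ℂ) := connectedComponentIn FTpre basePt

/-- `𝓕𝓣̂ = 𝓕𝓣̂₀ + V`. -/
def FThat : Set (Fin 5 → ℂ × ℂ) :=
  {u | ∃ w ∈ FThat₀, ∃ v ∈ Vset, u = fun i => covAct (v i) (w i)}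

abbrev CoverT : Type := ↥Cover

/-- The generator `(z; p, q)` of the free abelian group on `𝓒`. -/
def genOf (z : ℂ) (h : Reg z) (p q : ℤ) : FreeAbelianGroup CoverT :=
  FreeAbelianGroup.of ⟨pt z p q, pt_mem_Cover h p q⟩

/-- The lifted five term relators. -/
def FiveTermRels : Set (FreeAbelianGroup CoverT) :=
  {a | ∃ w : Fin 5 → ℂ × ℂ, w ∈ FThat ∧ ∃ hc : ∀ i, w i ∈ Cover,
    a = ∑ i : Fin 5, (-1 : ℤ) ^ (i : ℕ) • FreeAbelianGroup.of (⟨w i, hc i⟩ : CoverT)}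

/-- The transfer relators. -/
def TransferRels : Set (FreeAbelianGroup CoverT) :=
  {a | ∃ z : ℂ, ∃ h : Reg z, ∃ p q p' q' : ℤ,
    a = genOf z h p q + genOf z h p' q' - genOf z h p q' - genOf z h p' q}

def relSub : AddSubgroup (FreeAbelianGroup CoverT) :=
  AddSubgroup.closure (FiveTermRels ∪ TransferRels)

def relSub' : AddSubgroup (FreeAbelianGroup CoverT) :=
  AddSubgroup.closure FiveTermRels

/-- The extended pre-Bloch group `êP(ℂ)`. -/
abbrev EPreBloch : Type := FreeAbelianGroup CoverT ⧸ relSub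

/-- The variant `êP'(ℂ)` without the transfer relations. -/
abbrev EPreBloch' : Type := FreeAbelianGroup CoverT ⧸ relSub'

/-- The class `[z, p, q] ∈ êP(ℂ)` (junk value `0` if `z ∈ {0,1}`). -/
def cls (z : ℂ) (p q : ℤ) : EPreBloch :=
  if h : Reg z then QuotientAddGroup.mk (genOf z h p q) else 0

/-- The class `[z, p, q] ∈ êP'(ℂ)` (junk value `0` if `z ∈ {0,1}`). -/
def cls' (z : ℂ) (p q : ℤ) : EPreBloch' :=
  if h : Reg z then QuotientAddGroup.mk (genOf z h p q) else 0

/-- `ℂ ∧_ℤ ℂ`, the second exterior power of `ℂ` as a `ℤ`-module. -/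
abbrev L2C : Type := ↥(⋀[ℤ]^2 ℂ)

/-- The wedge `a ∧ b ∈ ℂ ∧_ℤ ℂ`. -/
def wedge (a b : ℂ) : L2C :=
  ⟨ExteriorAlgebra.ιMulti ℤ 2 ![a, b],
   ExteriorAlgebra.ιMulti_range ℤ 2 (Set.mem_range_self _)⟩

def nuFree : FreeAbelianGroup CoverT →+ L2C :=
  FreeAbelianGroup.lift fun w : CoverT => wedge w.1.1 w.1.2

/-- The homomorphism `ν : êP(ℂ) → ℂ ∧_ℤ ℂ`. -/
def nuHom : EPreBloch →+ L2C :=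
  if h : ∀ a ∈ relSub, nuFree a = 0 then QuotientAddGroup.lift relSub nuFree h else 0

/-- The homomorphism `ν : êP'(ℂ) → ℂ ∧_ℤ ℂ`. -/
def nuHom' : EPreBloch' →+ L2C :=
  if h : ∀ a ∈ relSub', nuFree a = 0 then QuotientAddGroup.lift relSub' nuFree h else 0

/-- The extended Bloch group `êB(ℂ) = ker ν`. -/
def EBloch : AddSubgroup EPreBloch := nuHom.ker

/-- `êB'(ℂ) = ker ν` on `êP'(ℂ)`. -/
def EBloch' : AddSubgroup EPreBloch' := nuHom'.ker

/-- The component `X₀₀` of `𝓒` (both fiber coordinates even). -/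
def X00 : Set (ℂ × ℂ) := {w | ∃ z : ℂ, Reg z ∧ ∃ p q : ℤ, w = pt z (2 * p) (2 * q)}

abbrev X00T : Type := ↥X00

lemma pt_mem_X00 {z : ℂ} (h : Reg z) (p q : ℤ) : pt z (2 * p) (2 * q) ∈ X00 :=
  ⟨z, h, p, q, rfl⟩

/-- The generator `(z; 2p, 2q)` of the free abelian group on `X₀₀`. -/
def genOf₀ (z : ℂ) (h : Reg z) (p q : ℤ) : FreeAbelianGroup X00T :=
  FreeAbelianGroup.of ⟨pt z (2 * p) (2 * q), pt_mem_X00 h p q⟩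

/-- The five term relators coming from `𝓕𝓣̂ ∩ (X₀₀)⁵`. -/
def FiveTermRels₀ : Set (FreeAbelianGroup X00T) :=
  {a | ∃ w : Fin 5 → ℂ × ℂ, w ∈ FThat ∧ ∃ hc : ∀ i, w i ∈ X00,
    a = ∑ i : Fin 5, (-1 : ℤ) ^ (i : ℕ) • FreeAbelianGroup.of (⟨w i, hc i⟩ : X00T)}

def relSub₀ : AddSubgroup (FreeAbelianGroup X00T) := AddSubgroup.closure FiveTermRels₀

/-- The true extended pre-Bloch group `êêP(ℂ)`. -/
abbrev EEPreBloch : Type := FreeAbelianGroup X00T ⧸ relSub₀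

/-- The class `[z, 2p, 2q] ∈ êêP(ℂ)` (junk value `0` if `z ∈ {0,1}`). -/
def cls₀ (z : ℂ) (p q : ℤ) : EEPreBloch :=
  if h : Reg z then QuotientAddGroup.mk (genOf₀ z h p q) else 0

def nuFree₀ : FreeAbelianGroup X00T →+ L2C :=
  FreeAbelianGroup.lift fun w : X00T => wedge w.1.1 w.1.2

/-- The homomorphism `ν̂ : êêP(ℂ) → ℂ ∧_ℤ ℂ`. -/
def nuHom₀ : EEPreBloch →+ L2C :=
  if h : ∀ a ∈ relSub₀, nuFree₀ a = 0 then QuotientAddGroup.lift relSub₀ nuFree₀ h else 0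

/-- The true extended Bloch group `êêB(ℂ) = ker ν̂`. -/
def EEBloch : AddSubgroup EEPreBloch := nuHom₀.ker

/-- The Rogers dilogarithm `𝓡(z) = ½ log z log(1-z) - ∫₀ᶻ log(1-t)/t dt` (straight segment,
parametrized by `t = s z`). -/
def rogers (z : ℂ) : ℂ :=
  (1 / 2) * Complex.log z * Complex.log (1 - z) -
    ∫ s in (0:ℝ)..(1:ℝ), Complex.log (1 - (s : ℂ) * z) / (s : ℂ)

/-- `R(z; p, q) = 𝓡(z) + (πi/2)(p log(1-z) + q log z) - π²/6`. -/
def Rfun (z : ℂ) (p q : ℤ) : ℂ :=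
  rogers z + (Cpi * I / 2) * (p * Complex.log (1 - z) + q * Complex.log z) - Cpi ^ 2 / 6

/-- `R̂(z; 2p, 2q) = 𝓡(z) + πi(p log(1-z) + q log z) - π²/6`. -/
def Rhat (z : ℂ) (p q : ℤ) : ℂ :=
  rogers z + Cpi * I * (p * Complex.log (1 - z) + q * Complex.log z) - Cpi ^ 2 / 6

/-- `ℂ / π²ℤ`. -/
abbrev ModPiSq : Type := ℂ ⧸ AddSubgroup.zmultiples (Cpi ^ 2)

/-- `ℂ / 2π²ℤ`. -/
abbrev Mod2PiSq : Type := ℂ ⧸ AddSubgroup.zmultiples (2 * Cpi ^ 2)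

abbrev RegT : Type := {z : ℂ // Reg z}

def pbGen (z : ℂ) (h : Reg z) : FreeAbelianGroup RegT := FreeAbelianGroup.of ⟨z, h⟩

/-- The five term relators for the classical pre-Bloch group. -/
def pbRels : Set (FreeAbelianGroup RegT) :=
  {a | ∃ x y : ℂ, ∃ hx : Reg x, ∃ hy : Reg y, x ≠ y ∧
    ∃ h2 : Reg (y / x), ∃ h3 : Reg ((1 - x⁻¹) / (1 - y⁻¹)), ∃ h4 : Reg ((1 - x) / (1 - y)),
    a = pbGen x hx - pbGen y hy + pbGen (y / x) h2 -
        pbGen ((1 - x⁻¹) / (1 - y⁻¹)) h3 + pbGen ((1 - x) / (1 - y)) h4}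

def pbSub : AddSubgroup (FreeAbelianGroup RegT) := AddSubgroup.closure pbRels

/-- The classical pre-Bloch group `P(ℂ)`. -/
abbrev PreBloch : Type := FreeAbelianGroup RegT ⧸ pbSub

/-- The class `[z] ∈ P(ℂ)` (junk value `0` if `z ∈ {0,1}`). -/
def pbCls (z : ℂ) : PreBloch :=
  if h : Reg z then QuotientAddGroup.mk (pbGen z h) else 0

/-- `ℂ* ∧_ℤ ℂ*`, the second exterior power of the multiplicative group `ℂ*` as `ℤ`-module. -/
abbrev L2CU : Type := ↥(⋀[ℤ]^2 (Additive ℂˣ))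

/-- The wedge `a ∧ b ∈ ℂ* ∧_ℤ ℂ*`. -/
def wedgeU (a b : ℂˣ) : L2CU :=
  ⟨ExteriorAlgebra.ιMulti ℤ 2 ![Additive.ofMul a, Additive.ofMul b],
   ExteriorAlgebra.ιMulti_range ℤ 2 (Set.mem_range_self _)⟩

def nuPBFree : FreeAbelianGroup RegT →+ L2CU :=
  FreeAbelianGroup.lift fun z : RegT =>
    2 • wedgeU (Units.mk0 z.1 z.2.1) (Units.mk0 (1 - z.1) (sub_ne_zero_of_ne (Ne.symm z.2.2)))

/-- The homomorphism `P(ℂ) → ℂ* ∧_ℤ ℂ*`, `[z] ↦ 2 (z ∧ (1-z))`. -/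
def nuPB : PreBloch →+ L2CU :=
  if h : ∀ a ∈ pbSub, nuPBFree a = 0 then QuotientAddGroup.lift pbSub nuPBFree h else 0

/-- The classical Bloch group `B(ℂ)`. -/
def Bloch : AddSubgroup PreBloch := nuPB.ker

/-- The roots of unity in `ℂ*`. -/
def muStar : Set ℂˣ := {ζ | ∃ n : ℕ, 0 < n ∧ ζ ^ n = 1}

abbrev SL2C := Matrix.SpecialLinearGroup (Fin 2) ℂ

/-- `PSL(2,ℂ) = SL(2,ℂ)/{±1}` as a discrete group. -/
abbrev PSL2C := SL2C ⧸ Subgroup.center SL2C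

/-- The boundary map `C₃ → C₂` of the inhomogeneous bar complex computing `H₃(PSL(2,ℂ);ℤ)`. -/
def d3 : FreeAbelianGroup (Fin 3 → PSL2C) →+ FreeAbelianGroup (Fin 2 → PSL2C) :=
  FreeAbelianGroup.lift fun g =>
    FreeAbelianGroup.of ![g 1, g 2] - FreeAbelianGroup.of ![g 0 * g 1, g 2] +
      FreeAbelianGroup.of ![g 0, g 1 * g 2] - FreeAbelianGroup.of ![g 0, g 1]

/-- The boundary map `C₄ → C₃` of the inhomogeneous bar complex computing `H₃(PSL(2,ℂ);ℤ)`. -/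
def d4 : FreeAbelianGroup (Fin 4 → PSL2C) →+ FreeAbelianGroup (Fin 3 → PSL2C) :=
  FreeAbelianGroup.lift fun g =>
    FreeAbelianGroup.of ![g 1, g 2, g 3] - FreeAbelianGroup.of ![g 0 * g 1, g 2, g 3] +
      FreeAbelianGroup.of ![g 0, g 1 * g 2, g 3] - FreeAbelianGroup.of ![g 0, g 1, g 2 * g 3] +
      FreeAbelianGroup.of ![g 0, g 1, g 2]

/-- `H₃(PSL(2,ℂ);ℤ)`, defined as homology of the inhomogeneous bar complex. -/
abbrev H3PSL2C : Type := ↥d3.ker ⧸ ((d4.range).addSubgroupOf d3.ker)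

/-- The set of combinatorial flattenings. -/
def Flattenings : Set (ℂ × ℂ × ℂ) :=
  {w | w.1 + w.2.1 + w.2.2 = 0 ∧ ∃ z : ℂ, Reg z ∧ ∃ p q r : ℤ,
    w.1 = Complex.log z + p * (Cpi * I) ∧
    w.2.1 = -Complex.log (1 - z) + q * (Cpi * I) ∧
    w.2.2 = Complex.log (1 - z) - Complex.log z + r * (Cpi * I)}

/-- The map `ℓ : 𝓒 → ℂ³`. -/
def ellMap (w : ℂ × ℂ) : ℂ × ℂ × ℂ := (w.1, w.2, -w.1 - w.2)

/-- The element `κ = [x,1,1] + [x,0,0] - [x,1,0] - [x,0,1] ∈ êP'(ℂ)`. -/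
def kap (x : ℂ) : EPreBloch' := cls' x 1 1 + cls' x 0 0 - cls' x 1 0 - cls' x 0 1

/-- The natural projection `êP'(ℂ) → êP(ℂ)`. -/
def projP : EPreBloch' →+ EPreBloch :=
  QuotientAddGroup.map relSub' relSub (AddMonoidHom.id _)
    (by
      rw [AddSubgroup.comap_id]
      exact AddSubgroup.closure_mono Set.subset_union_left)

/-- The barycentric description of the interior of the triangle with vertices `0, 1, y`, cleared
of denominators. -/
def InTriangle (x y : ℂ) : Prop :=
  0 < x.im ∧ 0 < y.im * x.re - y.re * x.im ∧ 0 < y.im - y.im * x.re + y.re * x.im - x.im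

lemma im_div_pos_iff (z w : ℂ) : 0 < (z / w).im ↔ 0 < z.im * w.re - z.re * w.im := by
  rcases eq_or_ne w 0 with rfl | hw
  · simp
  · have hn : 0 < normSq w := normSq_pos.2 hw
    rw [div_im, ← sub_div]
    exact div_pos_iff_of_pos_right hn

lemma inTriangle_iff_exists {x y : ℂ} (hy : 0 < y.im) :
    InTriangle x y ↔ ∃ s t : ℝ, 0 < s ∧ 0 < t ∧ s + t < 1 ∧ x = s + t * y := by
  constructor
  · rintro ⟨hb, h1, h0⟩
    refine ⟨(y.im * x.re - y.re * x.im) / y.im, x.im / y.im, div_pos h1 hy, div_pos hb hy, ?_, ?_⟩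
    · rw [← add_div, div_lt_one hy]
      linarith
    · apply Complex.ext
      · simp only [add_re, mul_re, ofReal_re, ofReal_im]
        field_simp
        ring
      · simp only [add_im, mul_im, ofReal_re, ofReal_im]
        field_simp
        ring
  · rintro ⟨s, t, hs, ht, hst, rfl⟩
    simp only [InTriangle, add_re, mul_re, ofReal_re, ofReal_im, add_im, mul_im]
    refine ⟨?_, ?_, ?_⟩
    · nlinarith [mul_pos ht hy]
    · nlinarith [mul_pos hs hy]
    · nlinarith [mul_pos (sub_pos.2 hst) hy]

lemma im_fourth_pos {x y : ℂ} (hy : 0 < y.im) (h : InTriangle x y) :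
    0 < ((1 - x⁻¹) / (1 - y⁻¹)).im := by
  have hx0 : x ≠ 0 := fun e => by simpa [e] using h.1
  have hy0 : y ≠ 0 := fun e => by simp [e] at hy
  have hy1 : y - 1 ≠ 0 := fun e => by
    rw [sub_eq_zero.1 e] at hy
    simp at hy
  have e : (1 - x⁻¹) / (1 - y⁻¹) = ((x - 1) * y) / (x * (y - 1)) := by
    have : 1 - y⁻¹ = (y - 1) / y := by field_simp
    rw [this]
    field_simp
  obtain ⟨s, t, hs, ht, hst, rfl⟩ := (inTriangle_iff_exists hy).1 h
  rw [e, im_div_pos_iff]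
  simp only [add_re, mul_re, ofReal_re, ofReal_im, add_im, mul_im, sub_re, sub_im, one_re, one_im]
  have hr : 0 < 1 - s - t := by linarith
  have key : 0 < y.im * ((1 - s - t) * s + s * t * ((1 - y.re) ^ 2 + y.im ^ 2)
      + (1 - s - t) * t * (y.re ^ 2 + y.im ^ 2)) := by positivity
  refine key.trans_eq ?_
  ring

lemma forall_ftTuple_mem_UHP_iff (x y : ℂ) :
    (∀ i, ftTuple x y i ∈ UHP) ↔ 0 < y.im ∧ InTriangle x y := by
  have h2 : 0 < (y / x).im ↔ 0 < y.im * x.re - y.re * x.im := im_div_pos_iff y x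
  have h4 : 0 < ((1 - x) / (1 - y)).im ↔
      0 < y.im - y.im * x.re + y.re * x.im - x.im := by
    rw [im_div_pos_iff]
    simp only [sub_re, sub_im, one_re, one_im]
    ring_nf
  have h : (∀ i, ftTuple x y i ∈ UHP) ↔ 0 < x.im ∧ 0 < y.im ∧ 0 < (y / x).im ∧
      0 < ((1 - x⁻¹) / (1 - y⁻¹)).im ∧ 0 < ((1 - x) / (1 - y)).im := by
    simp [Fin.forall_fin_succ, ftTuple, UHP]
  rw [h]
  constructor
  · rintro ⟨hx, hy, k2, -, k4⟩
    exact ⟨hy, hx, h2.1 k2, h4.1 k4⟩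
  · rintro ⟨hy, hT⟩
    exact ⟨hT.1, hy, h2.2 hT.2.1, im_fourth_pos hy hT, h4.2 hT.2.2⟩

lemma convex_setOf_im_mul_add_nonneg (p q : ℂ) : Convex ℝ {z : ℂ | 0 ≤ (q * z + p).im} := by
  intro z hz w hw a b ha hb hab
  have e : q * (a • z + b • w) + p = a • (q * z + p) + b • (q * w + p) := by
    have : (a : ℂ) + b = 1 := by exact_mod_cast hab
    simp only [real_smul]
    linear_combination (-p) * this
  simp only [Set.mem_ofPred_eq] at hz hw ⊢
  rw [e, add_im, smul_im, smul_im]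
  exact add_nonneg (mul_nonneg ha hz) (mul_nonneg hb hw)

lemma im_mul_add_pos_of_mem_interior {s : Set ℂ} {x p q : ℂ} (hq : q ≠ 0)
    (hs : s ⊆ {z | 0 ≤ (q * z + p).im}) (hx : x ∈ interior s) : 0 < (q * x + p).im := by
  have ho : IsOpenMap fun z : ℂ => (q * z + p).im :=
    isOpenMap_im.comp ((isOpenMap_add_right p).comp (Homeomorph.mulLeft₀ q hq).isOpenMap)
  have hc : Continuous fun z : ℂ => (q * z + p).im := by fun_prop
  have h := interior_mono hs hx
  have e : {z : ℂ | 0 ≤ (q * z + p).im} = (fun z : ℂ => (q * z + p).im) ⁻¹' Set.Ici 0 := rfl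
  rw [e, ← ho.preimage_interior_eq_interior_preimage hc, interior_Ici] at h
  exact h

lemma mem_interior_triangle_iff {x y : ℂ} (hy : 0 < y.im) :
    x ∈ interior (convexHull ℝ ({0, 1, y} : Set ℂ)) ↔ InTriangle x y := by
  constructor
  · intro hx
    have key : ∀ p q : ℂ, q ≠ 0 → 0 ≤ p.im → 0 ≤ (q + p).im → 0 ≤ (q * y + p).im →
        0 < (q * x + p).im := by
      intro p q hq h0 h1 h2
      refine im_mul_add_pos_of_mem_interior hq
        (convexHull_min ?_ (convex_setOf_im_mul_add_nonneg p q)) hx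
      rintro z (rfl | rfl | rfl)
      · simpa using h0
      · simpa using h1
      · exact h2
    have hb := key 0 1 one_ne_zero (by simp) (by simp) (by simpa using hy.le)
    have h1 := key 0 ⟨-y.re, y.im⟩ (fun e => hy.ne' (congrArg im e)) (by simp)
      (by simpa using hy.le) (by simp [mul_comm])
    have h0 := key ⟨0, y.im⟩ ⟨y.re - 1, -y.im⟩ (fun e => hy.ne' (neg_eq_zero.1 (congrArg im e)))
      hy.le (by simp) (by simp [mul_im]; linarith)
    simp only [add_im, mul_im, one_re, one_im, zero_im] at hb h1 h0
    exact ⟨by linarith, by linarith, by linarith⟩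
  · intro hx
    have ho : IsOpen {z : ℂ | InTriangle z y} := by
      have c : Continuous fun _ : ℂ => (0 : ℝ) := continuous_const
      exact (isOpen_lt c (by fun_prop)).inter
        ((isOpen_lt c (by fun_prop)).inter (isOpen_lt c (by fun_prop)))
    refine interior_maximal (fun z hz => ?_) ho hx
    obtain ⟨s, t, hs, ht, hst, rfl⟩ := (inTriangle_iff_exists hy).1 hz
    have hc := convex_convexHull ℝ ({0, 1, y} : Set ℂ)
    have m : ∀ w ∈ ({0, 1, y} : Set ℂ), w ∈ convexHull ℝ ({0, 1, y} : Set ℂ) :=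
      fun w hw => subset_convexHull ℝ _ hw
    have hpos : 0 < s + t := add_pos hs ht
    have h1 := hc (m 1 (by simp)) (m y (by simp)) (div_pos hs hpos).le (div_pos ht hpos).le
      (by field_simp)
    have h2 := hc (m 0 (by simp)) h1 (sub_pos.2 hst).le hpos.le (by ring)
    convert h2 using 1
    have hne : (s : ℂ) + t ≠ 0 := by exact_mod_cast hpos.ne'
    simp only [real_smul]
    push_cast
    field_simp
    ring

lemma reg_of_im_pos {z : ℂ} (hz : 0 < z.im) : Reg z :=
  ⟨fun e => by simp [e] at hz, fun e => by simp [e] at hz⟩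

/-- The parameter domain of `FT⁺`: the point `y` together with barycentric coordinates. -/
def triangleParams : Set (ℂ × ℝ × ℝ) :=
  {u | 0 < u.1.im ∧ 0 < u.2.1 ∧ 0 < u.2.2 ∧ 0 < 1 - u.2.1 - u.2.2}

lemma convex_triangleParams : Convex ℝ triangleParams := by
  rw [convex_iff_forall_pos]
  rintro ⟨y, s, t⟩ ⟨h1, h2, h3, h4⟩ ⟨y', s', t'⟩ ⟨k1, k2, k3, k4⟩ a b ha hb hab
  simp only [triangleParams, Set.mem_ofPred_eq, Prod.smul_mk, Prod.mk_add_mk, add_im, smul_im,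
    smul_eq_mul] at *
  refine ⟨by positivity, by positivity, by positivity, ?_⟩
  nlinarith [mul_pos ha h4, mul_pos hb k4]

lemma FTplus_eq_image :
    FTplus = (fun u : ℂ × ℝ × ℝ => ftTuple (u.2.1 + u.2.2 * u.1) u.1) '' triangleParams := by
  ext v
  constructor
  · rintro ⟨⟨x, y, -, -, -, rfl⟩, h⟩
    obtain ⟨hy, hT⟩ := (forall_ftTuple_mem_UHP_iff x y).1 h
    obtain ⟨s, t, hs, ht, hst, rfl⟩ := (inTriangle_iff_exists hy).1 hT
    exact ⟨(y, s, t), ⟨hy, hs, ht, by linarith⟩, rfl⟩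
  · rintro ⟨⟨y, s, t⟩, ⟨hy, hs, ht, hst⟩, rfl⟩
    dsimp only at hy hs ht hst
    have hT : InTriangle (s + t * y) y :=
      (inTriangle_iff_exists hy).2 ⟨s, t, hs, ht, by linarith, rfl⟩
    refine ⟨⟨_, y, reg_of_im_pos hT.1, reg_of_im_pos hy, fun e => ?_, rfl⟩,
      (forall_ftTuple_mem_UHP_iff _ y).2 ⟨hy, hT⟩⟩
    have := congrArg im e
    simp only [add_im, mul_im, ofReal_re, ofReal_im] at this
    nlinarith [mul_pos (show 0 < 1 - t by linarith) hy]

lemma continuousOn_ftTuple :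
    ContinuousOn (fun u : ℂ × ℝ × ℝ => ftTuple (u.2.1 + u.2.2 * u.1) u.1) triangleParams := by
  have hx : ∀ u ∈ triangleParams, Reg ((u.2.1 : ℂ) + u.2.2 * u.1) := fun u hu =>
    reg_of_im_pos (by simpa using mul_pos hu.2.2.1 hu.1)
  have hy : ∀ u ∈ triangleParams, Reg u.1 := fun u hu => reg_of_im_pos hu.1
  have cx : ContinuousOn (fun u : ℂ × ℝ × ℝ => (u.2.1 : ℂ) + u.2.2 * u.1) triangleParams := by
    fun_prop
  have cy : ContinuousOn (fun u : ℂ × ℝ × ℝ => u.1) triangleParams := by fun_prop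
  have c1 : ContinuousOn (fun _ : ℂ × ℝ × ℝ => (1 : ℂ)) triangleParams := continuousOn_const
  refine continuousOn_pi.2 fun i => ?_
  fin_cases i
  · exact cx
  · exact cy
  · exact cy.div cx fun u hu => (hx u hu).1
  · refine (c1.sub (cx.inv₀ fun u hu => (hx u hu).1)).div
      (c1.sub (cy.inv₀ fun u hu => (hy u hu).1)) fun u hu => ?_
    exact sub_ne_zero.2 fun e => (hy u hu).2 (inv_eq_one.1 e.symm)
  · exact (c1.sub cx).div (c1.sub cy) fun u hu => sub_ne_zero.2 (hy u hu).2.symm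

lemma isConnected_FTplus : IsConnected FTplus := by
  rw [FTplus_eq_image]
  refine IsConnected.image ⟨⟨(I, 1 / 4, 1 / 4), ?_⟩, convex_triangleParams.isPreconnected⟩ _
    continuousOn_ftTuple
  norm_num [triangleParams]

/-- A tuple `(x, y, y/x, (1-x⁻¹)/(1-y⁻¹), (1-x)/(1-y)) ∈ FT` lies in `FT⁺` if and
only if `y` lies in the open upper half-plane and `x` lies in the interior of the triangle with
vertices `0, 1, y`.  Moreover `FT⁺` is connected. -/
theorem stmt0 :
    (∀ x y : ℂ, Reg x → Reg y → x ≠ y →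
      (ftTuple x y ∈ FTplus ↔
        y ∈ UHP ∧ x ∈ interior (convexHull ℝ ({0, 1, y} : Set ℂ)))) ∧
    IsConnected FTplus := by
  refine ⟨fun x y hx hy hxy => ?_, isConnected_FTplus⟩
  have hFT : ftTuple x y ∈ FT := ⟨x, y, hx, hy, hxy, rfl⟩
  have h : ftTuple x y ∈ FTplus ↔ ∀ i, ftTuple x y i ∈ UHP := and_iff_right hFT
  rw [h, forall_ftTuple_mem_UHP_iff]
  exact and_congr_right fun hy => (mem_interior_triangle_iff hy).symm

end ExtendedBloch

end
end

section
/- Fix integers p₀,p₁,p₂,p₃,p₄ and q₀,q₁,q₂,q₃,q₄. The element Σᵢ₌₀⁴ (-1)ⁱ (Log xᵢ + pᵢπi) ∧ (-Log(1-xᵢ) + qᵢπi) of ℂ ∧_ℤ ℂ vanishes for every tuple (x₀,…,x₄) ∈ FT⁺ if and only if p₂ = p₁-p₀, p₃ = p₁-p₀+q₁-q₀, q₃ = q₂-q₁, p₄ = q₁-q₀ and q₄ = q₂-q₁-p₀. -/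
open Complex
open scoped Classical

noncomputable section

namespace ExtendedBloch

lemma wedge_eq_ιMulti (a b : ℂ) : wedge a b = exteriorPower.ιMulti ℤ 2 ![a, b] := rfl

lemma coe_wedge (a b : ℂ) :
    (wedge a b : ExteriorAlgebra ℤ ℂ) = ExteriorAlgebra.ι ℤ a * ExteriorAlgebra.ι ℤ b := by
  simp [wedge, ExteriorAlgebra.ιMulti_apply]

lemma wedge_add_left (a b c : ℂ) : wedge (a + b) c = wedge a c + wedge b c :=
  Subtype.ext (by simp [coe_wedge, add_mul])

lemma wedge_add_right (a b c : ℂ) : wedge a (b + c) = wedge a b + wedge a c :=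
  Subtype.ext (by simp [coe_wedge, mul_add])

lemma wedge_neg_left (a b : ℂ) : wedge (-a) b = -wedge a b :=
  Subtype.ext (by simp [coe_wedge])

lemma wedge_neg_right (a b : ℂ) : wedge a (-b) = -wedge a b :=
  Subtype.ext (by simp [coe_wedge])

lemma wedge_zsmul_left (n : ℤ) (a b : ℂ) : wedge (n • a) b = n • wedge a b := by
  apply Subtype.ext
  rw [Submodule.coe_smul, coe_wedge, coe_wedge, map_zsmul, smul_mul_assoc]

lemma wedge_zsmul_right (n : ℤ) (a b : ℂ) : wedge a (n • b) = n • wedge a b := by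
  apply Subtype.ext
  rw [Submodule.coe_smul, coe_wedge, coe_wedge, map_zsmul, mul_smul_comm]

lemma wedge_self (a : ℂ) : wedge a a = 0 :=
  Subtype.ext (by simp [coe_wedge])

lemma wedge_swap (a b : ℂ) : wedge b a = -wedge a b := by
  apply Subtype.ext
  rw [Submodule.coe_neg, coe_wedge, coe_wedge]
  exact eq_neg_of_add_eq_zero_left (ExteriorAlgebra.ι_add_mul_swap b a)

lemma wedge_zero_left (b : ℂ) : wedge 0 b = 0 :=
  Subtype.ext (by simp [coe_wedge])

/-- The determinant `(u, v) ↦ re u * im v - re v * im u` as an alternating form over `ℤ`. -/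
def realDet : ℂ [⋀^Fin 2]→ₗ[ℤ] ℝ where
  toFun m := (m 0).re * (m 1).im - (m 1).re * (m 0).im
  map_update_add' m i a b := by
    fin_cases i <;> simp [Function.update] <;> ring
  map_update_smul' m i n a := by
    fin_cases i <;> simp [Function.update] <;> ring
  map_eq_zero_of_eq' m i j h hij := by
    fin_cases i <;> fin_cases j <;> simp_all

lemma re_eq_zero_of_wedge_eq_zero {z : ℂ} (h : wedge z (Cpi * I) = 0) : z.re = 0 := by
  have h1 := congrArg (exteriorPower.alternatingMapLinearEquiv realDet) h
  rw [wedge_eq_ιMulti, exteriorPower.alternatingMapLinearEquiv_apply_ιMulti, map_zero] at h1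
  simpa [realDet, Cpi, Real.pi_ne_zero] using h1

/-- The alternating sum of wedges, when the logarithms are expressed through five of them. -/
lemma sum_wedge_eq (a b c d f e : ℂ) (p q : Fin 5 → ℤ) (L M : Fin 5 → ℂ)
    (hL : L = ![a, b, b - a, b - a + c - d, c - d])
    (hM : M = ![c, d, f, f - d, a + f - d]) :
    ∑ i : Fin 5, (-1 : ℤ) ^ (i : ℕ) • wedge (L i + p i * e) (-M i + q i * e) =
      wedge ((q 0 - q 2 + q 3 + p 4) • a + (q 2 - q 1 - q 3) • b + (p 0 - q 3 + q 4) • c +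
        (q 3 + p 3 - p 1 - q 4 - p 4) • d + (p 2 - p 3 + p 4) • f) e := by
  subst hL hM
  simp only [← zsmul_eq_mul, Fin.sum_univ_five, sub_eq_add_neg, Matrix.cons_val, neg_add, neg_neg,
    wedge_add_left, wedge_add_right, wedge_neg_left, wedge_neg_right, wedge_zsmul_left,
    wedge_zsmul_right, wedge_self, wedge_swap a c, wedge_swap a d, wedge_swap a e,
    wedge_swap c e, wedge_swap d e, wedge_swap f e]
  norm_num
  module

lemma eq_zero_of_sum_mul_log_eq_zero {ι : Type*} [Fintype ι] (c : ι → ℤ) (n : ι → ℕ)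
    (hn : ∀ i, n i ≠ 0) (h : ∑ i, (c i : ℝ) * Real.log (n i) = 0) (l : ℕ) [Fact l.Prime] (j : ι)
    (hj : l ∣ n j) (hl : ∀ i, i ≠ j → ¬ l ∣ n i) : c j = 0 := by
  have h1 : ∏ i, (n i : ℝ) ^ c i = 1 := by
    have hpos : ∀ i, (0 : ℝ) < (n i : ℝ) ^ c i := fun i =>
      zpow_pos (Nat.cast_pos.2 (Nat.pos_of_ne_zero (hn i))) _
    apply Real.eq_one_of_pos_of_log_eq_zero (Finset.prod_pos fun i _ => hpos i)
    rw [Real.log_prod fun i _ => (hpos i).ne']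
    simpa [Real.log_zpow] using h
  have h2 : ∏ i, (n i : ℚ) ^ c i = 1 := by
    apply Rat.cast_injective (α := ℝ)
    push_cast
    exact h1
  have h3 : ∏ i, (n i : ℚ_[l]) ^ c i = 1 := by
    simpa using congrArg (Rat.cast : ℚ → ℚ_[l]) h2
  have h4 := congrArg norm h3
  rw [norm_prod, Finset.prod_eq_single j, norm_zpow, norm_one] at h4
  · have hlt : ‖(n j : ℚ_[l])‖ < 1 := Padic.norm_natCast_lt_one_iff.2 hj
    have hpos : 0 < ‖(n j : ℚ_[l])‖ := norm_pos_iff.2 (Nat.cast_ne_zero.2 (hn j))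
    exact (zpow_eq_one_iff_right₀ hpos.le hlt.ne).1 h4
  · intro i _ hi
    have hco : l.Coprime (n i) := (Nat.Prime.coprime_iff_not_dvd Fact.out).2 (hl i hi)
    rw [norm_zpow, Padic.norm_natCast_eq_one_iff.2 hco, one_zpow]
  · simp

lemma log_eq_of_exp_eq {z u : ℂ} (hz : z ≠ 0) (h : exp u = z)
    (h1 : -(2 * Real.pi) < (log z).im - u.im) (h2 : (log z).im - u.im < 2 * Real.pi) :
    log z = u := by
  obtain ⟨n, hn⟩ := exp_eq_exp_iff_exists_int.1 ((exp_log hz).trans h.symm)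
  have him : (log z).im - u.im = n * (2 * Real.pi) := by
    rw [hn]; simp
  rw [him] at h1 h2
  have hpi := Real.two_pi_pos
  have hn1 : (n : ℝ) < 1 := by nlinarith
  have hn2 : (-1 : ℝ) < n := by nlinarith
  have : n = 0 := by
    have : n < 1 := by exact_mod_cast hn1
    have : -1 < n := by exact_mod_cast hn2
    omega
  simpa [this] using hn

lemma log_im_mem_of_mem_UHP {z : ℂ} (h : z ∈ UHP) : 0 < (log z).im ∧ (log z).im < Real.pi := by
  have h : 0 < z.im := h
  rw [log_im]
  refine ⟨lt_of_le_of_ne (arg_nonneg_iff.2 h.le) fun h0 => ?_, arg_lt_pi_iff.2 (Or.inr h.ne')⟩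
  exact h.ne' (arg_eq_zero_iff.1 h0.symm).2

lemma log_one_sub_im_mem_of_mem_UHP {z : ℂ} (h : z ∈ UHP) :
    -Real.pi < (log (1 - z)).im ∧ (log (1 - z)).im < 0 := by
  have h : 0 < z.im := h
  exact ⟨neg_pi_lt_log_im _, by rw [log_im, arg_neg_iff]; simpa using h⟩

lemma ne_zero_of_mem_UHP {z : ℂ} (h : z ∈ UHP) : z ≠ 0 := by
  rintro rfl
  simp [UHP] at h

lemma one_sub_ne_zero_of_mem_UHP {z : ℂ} (h : z ∈ UHP) : 1 - z ≠ 0 := by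
  intro h0
  rw [← sub_eq_zero.1 h0] at h
  simp [UHP] at h

lemma log_ftTuple {x y : ℂ} (h : ∀ i, ftTuple x y i ∈ UHP) :
    (fun i => log (ftTuple x y i)) = ![log x, log y, log y - log x,
      log y - log x + log (1 - x) - log (1 - y), log (1 - x) - log (1 - y)] := by
  have hx : x ∈ UHP := h 0
  have hy : y ∈ UHP := h 1
  have hx0 := ne_zero_of_mem_UHP hx
  have hy0 := ne_zero_of_mem_UHP hy
  have hx1 := one_sub_ne_zero_of_mem_UHP hx
  have hy1 := one_sub_ne_zero_of_mem_UHP hy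
  obtain ⟨a0, a1⟩ := log_im_mem_of_mem_UHP hx
  obtain ⟨b0, b1⟩ := log_im_mem_of_mem_UHP hy
  obtain ⟨c0, c1⟩ := log_one_sub_im_mem_of_mem_UHP hx
  obtain ⟨d0, d1⟩ := log_one_sub_im_mem_of_mem_UHP hy
  obtain ⟨u0, u1⟩ := log_im_mem_of_mem_UHP (h 2)
  obtain ⟨v0, v1⟩ := log_im_mem_of_mem_UHP (h 3)
  obtain ⟨w0, w1⟩ := log_im_mem_of_mem_UHP (h 4)
  have e2 : log (ftTuple x y 2) = log y - log x := by
    apply log_eq_of_exp_eq (ne_zero_of_mem_UHP (h 2))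
    · simp [ftTuple, exp_sub, exp_log, *]
    all_goals simp only [sub_im]; linarith
  have e4 : log (ftTuple x y 4) = log (1 - x) - log (1 - y) := by
    apply log_eq_of_exp_eq (ne_zero_of_mem_UHP (h 4))
    · simp [ftTuple, exp_sub, exp_log, *]
    all_goals simp only [sub_im]; linarith
  have e3 : log (ftTuple x y 3) = log y - log x + log (1 - x) - log (1 - y) := by
    apply log_eq_of_exp_eq (ne_zero_of_mem_UHP (h 3))
    · have : y - 1 ≠ 0 := sub_ne_zero.2 (sub_ne_zero.1 hy1).symm
      simp only [exp_sub, exp_add, exp_log hx0, exp_log hy0, exp_log hx1, exp_log hy1, ftTuple,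
        Matrix.cons_val]
      field_simp
      ring
    all_goals
      rw [e2] at u0 u1
      rw [e4] at w0 w1
      simp only [sub_im, add_im] at *
      linarith
  ext i
  fin_cases i
  exacts [rfl, rfl, e2, e3, e4]

lemma log_one_sub_ftTuple {x y : ℂ} (h : ∀ i, ftTuple x y i ∈ UHP) :
    (fun i => log (1 - ftTuple x y i)) = ![log (1 - x), log (1 - y), log (1 - y / x),
      log (1 - y / x) - log (1 - y), log x + log (1 - y / x) - log (1 - y)] := by
  have hx : x ∈ UHP := h 0
  have hy : y ∈ UHP := h 1
  have hz : y / x ∈ UHP := h 2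
  have hx0 := ne_zero_of_mem_UHP hx
  have hy0 := ne_zero_of_mem_UHP hy
  have hy1 := one_sub_ne_zero_of_mem_UHP hy
  have hz1 := one_sub_ne_zero_of_mem_UHP hz
  have hy1' : y - 1 ≠ 0 := sub_ne_zero.2 (sub_ne_zero.1 hy1).symm
  obtain ⟨a0, a1⟩ := log_im_mem_of_mem_UHP hx
  obtain ⟨d0, d1⟩ := log_one_sub_im_mem_of_mem_UHP hy
  obtain ⟨f0, f1⟩ := log_one_sub_im_mem_of_mem_UHP hz
  obtain ⟨v0, v1⟩ := log_one_sub_im_mem_of_mem_UHP (h 3)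
  obtain ⟨w0, w1⟩ := log_one_sub_im_mem_of_mem_UHP (h 4)
  have e3 : log (1 - ftTuple x y 3) = log (1 - y / x) - log (1 - y) := by
    apply log_eq_of_exp_eq (one_sub_ne_zero_of_mem_UHP (h 3))
    · simp only [exp_sub, exp_log hz1, exp_log hy1, ftTuple, Matrix.cons_val]
      field_simp
      ring
    all_goals simp only [sub_im]; linarith
  have e4 : log (1 - ftTuple x y 4) = log x + log (1 - y / x) - log (1 - y) := by
    apply log_eq_of_exp_eq (one_sub_ne_zero_of_mem_UHP (h 4))
    · simp only [exp_sub, exp_add, exp_log hx0, exp_log hz1, exp_log hy1, ftTuple, Matrix.cons_val]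
      field_simp
      ring
    all_goals
      rw [e3] at v0 v1
      simp only [sub_im, add_im] at *
      linarith
  ext i
  fin_cases i
  exacts [rfl, rfl, rfl, e3, e4]

lemma sum_wedge_ftTuple {x y : ℂ} (h : ∀ i, ftTuple x y i ∈ UHP) (p q : Fin 5 → ℤ) :
    ∑ i : Fin 5, (-1 : ℤ) ^ (i : ℕ) •
        wedge (Complex.log (ftTuple x y i) + p i * (Cpi * I))
          (-Complex.log (1 - ftTuple x y i) + q i * (Cpi * I)) =
      wedge ((q 0 - q 2 + q 3 + p 4) • log x + (q 2 - q 1 - q 3) • log y +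
        (p 0 - q 3 + q 4) • log (1 - x) + (q 3 + p 3 - p 1 - q 4 - p 4) • log (1 - y) +
        (p 2 - p 3 + p 4) • log (1 - y / x)) (Cpi * I) :=
  sum_wedge_eq _ _ _ _ _ (Cpi * I) p q _ _ (log_ftTuple h) (log_one_sub_ftTuple h)

lemma log_re_eq_log_natCast {z : ℂ} {n : ℕ} (h : normSq z = n) :
    (log z).re = Real.log n / 2 := by
  rw [log_re, ← h, normSq_eq_norm_sq, Real.log_pow]
  push_cast
  ring

lemma ftTuple_gaussian_mem_UHP (i : Fin 5) : ftTuple (2 + 5 * I) (3 + 8 * I) i ∈ UHP := by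
  fin_cases i <;> simp [ftTuple, UHP, div_im, normSq_apply] <;> norm_num

lemma ftTuple_gaussian_mem_FTplus : ftTuple (2 + 5 * I) (3 + 8 * I) ∈ FTplus := by
  refine ⟨⟨_, _, ⟨?_, ?_⟩, ⟨?_, ?_⟩, ?_, rfl⟩, ftTuple_gaussian_mem_UHP⟩ <;>
    simp [Complex.ext_iff]

/-- the element `Σᵢ (-1)ⁱ (Log xᵢ + pᵢπi) ∧ (-Log(1-xᵢ) + qᵢπi)` of `ℂ ∧_ℤ ℂ`
vanishes for every tuple in `FT⁺` iff the five relations on the `pᵢ, qᵢ` hold. -/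
theorem stmt1 (p q : Fin 5 → ℤ) :
    (∀ v ∈ FTplus, ∑ i : Fin 5, (-1 : ℤ) ^ (i : ℕ) •
        wedge (Complex.log (v i) + p i * (Cpi * I)) (-Complex.log (1 - v i) + q i * (Cpi * I))
          = 0) ↔
    (p 2 = p 1 - p 0 ∧ p 3 = p 1 - p 0 + q 1 - q 0 ∧ q 3 = q 2 - q 1 ∧
      p 4 = q 1 - q 0 ∧ q 4 = q 2 - q 1 - p 0) := by
  constructor
  · intro h
    have hw := h _ ftTuple_gaussian_mem_FTplus
    rw [sum_wedge_ftTuple ftTuple_gaussian_mem_UHP] at hw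
    have hre := re_eq_zero_of_wedge_eq_zero hw
    have hx : (log (2 + 5 * I)).re = Real.log (29 : ℕ) / 2 :=
      log_re_eq_log_natCast (by simp [normSq_apply]; norm_num)
    have hy : (log (3 + 8 * I)).re = Real.log (73 : ℕ) / 2 :=
      log_re_eq_log_natCast (by simp [normSq_apply]; norm_num)
    have hx1 : (log (1 - (2 + 5 * I))).re = Real.log (26 : ℕ) / 2 :=
      log_re_eq_log_natCast (by simp [normSq_apply]; norm_num)
    have hy1 : (log (1 - (3 + 8 * I))).re = Real.log (68 : ℕ) / 2 :=
      log_re_eq_log_natCast (by simp [normSq_apply]; norm_num)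
    have hyx : (log (1 - (3 + 8 * I) / (2 + 5 * I))).re =
        Real.log (10 : ℕ) / 2 - Real.log (29 : ℕ) / 2 := by
      have hx0 : (2 + 5 * I : ℂ) ≠ 0 := by simp [Complex.ext_iff]
      have hxy : (2 + 5 * I - (3 + 8 * I) : ℂ) ≠ 0 := by simp [Complex.ext_iff]; norm_num
      rw [one_sub_div hx0, log_re, norm_div, Real.log_div (norm_ne_zero_iff.2 hxy)
        (norm_ne_zero_iff.2 hx0), ← log_re, ← log_re, hx,
        log_re_eq_log_natCast (n := 10) (by simp [normSq_apply]; norm_num)]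
    simp only [add_re, zsmul_eq_mul, ← ofReal_intCast, re_ofReal_mul, hx, hy, hx1, hy1, hyx] at hre
    set c : Fin 5 → ℤ := ![q 0 - q 2 + q 3 + p 4 - (p 2 - p 3 + p 4), q 2 - q 1 - q 3,
      p 0 - q 3 + q 4, q 3 + p 3 - p 1 - q 4 - p 4, p 2 - p 3 + p 4] with hc
    have hsum : ∑ i, (c i : ℝ) * Real.log ((![29, 73, 26, 68, 10] : Fin 5 → ℕ) i) = 0 := by
      simp only [hc, Fin.sum_univ_five, Matrix.cons_val]
      push_cast at hre ⊢
      linarith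
    have key := eq_zero_of_sum_mul_log_eq_zero c _ (by decide) hsum
    have h0 := @key 29 ⟨by norm_num⟩ 0 (by decide) (by decide)
    have h1 := @key 73 ⟨by norm_num⟩ 1 (by decide) (by decide)
    have h2 := @key 13 ⟨by norm_num⟩ 2 (by decide) (by decide)
    have h3 := @key 17 ⟨by norm_num⟩ 3 (by decide) (by decide)
    have h4 := @key 5 ⟨by norm_num⟩ 4 (by decide) (by decide)
    simp only [hc, Matrix.cons_val] at h0 h1 h2 h3 h4
    omega
  · rintro ⟨h1, h2, h3, h4, h5⟩ v ⟨⟨x, y, -, -, -, rfl⟩, hv⟩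
    rw [sum_wedge_ftTuple hv, show q 0 - q 2 + q 3 + p 4 = 0 by omega,
      show q 2 - q 1 - q 3 = 0 by omega, show p 0 - q 3 + q 4 = 0 by omega,
      show q 3 + p 3 - p 1 - q 4 - p 4 = 0 by omega, show p 2 - p 3 + p 4 = 0 by omega]
    simp only [zero_smul, add_zero, wedge_zero_left]

end ExtendedBloch

end
end
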